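/- Let 1∈E be an even vector and let a(𝐳), b(𝐳) be local homogeneous End(E)-valued distributions that are weakly creative (i.e. a(𝐳)1, b(𝐳)1 ∈ E[[𝐳]]), with a reduced OPE {c^i(𝐳,𝐰), 𝐡_i}_{1≤i≤r}. Then c^i(𝐳,𝐰)1 ∈ E[[𝐳,𝐰]] for every i, i.e. each c^i(𝐳,𝐰)1 is a power series in both variable pairs. -/

import Mathlib

open scoped BigOperators Classical

noncomputable section

namespace OPEA

variable (K : Type*) [Field K] [CharZero K]

/-- index pairs 𝐧 = (n, n̄) ∈ K² -/
abbrev Idx := K × K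

def IsInt (x : K) : Prop := ∃ k : ℤ, (k : K) = x

def IsNegInt (x : K) : Prop := ∃ k : ℤ, k < 0 ∧ (k : K) = x

/-- 𝕂̄ = {𝐧 ∈ K² | n − n̄ ∈ ℤ} -/
def Kbar (n : Idx K) : Prop := IsInt K (n.1 - n.2)

def IsIntPair (n : Idx K) : Prop := IsInt K n.1 ∧ IsInt K n.2

/-- generalized binomial coefficient C(x,k) -/
def gchoose (x : K) (k : ℕ) : K :=
  (∏ i ∈ Finset.range k, (x - (i : K))) / (k.factorial : K)

/-- (−1)^x for x an integer image in K (and 1 otherwise) -/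
def negOnePow (x : K) : K :=
  if h : ∃ k : ℤ, (k : K) = x then (-1 : K) ^ h.choose else 1

variable (M : Type*) [AddCommGroup M] [Module K M]

/-- M-valued distribution in one variable pair -/
abbrev Dist1 := Idx K → M

/-- M-valued distribution in two variable pairs -/
abbrev Dist2 := Idx K → Idx K → M

/-- M-valued distribution in r variable pairs -/
abbrev DistN (r : ℕ) := (Fin r → Idx K) → M

/-- membership in M[[𝐳]] -/
def IsPow1 (a : Dist1 K M) : Prop := ∀ n, a n ≠ 0 → IsNegInt K n.1 ∧ IsNegInt K n.2

/-- membership in M⌊𝐳⌋ -/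
def InLat1 (a : Dist1 K M) : Prop :=
  ∃ S : Finset (Idx K), ∀ n, a n ≠ 0 →
    ∃ m ∈ S, IsNegInt K (n.1 - m.1) ∧ IsNegInt K (n.2 - m.2)

/-- membership in M[[𝐳,𝐰]] -/
def IsPow2 (a : Dist2 K M) : Prop :=
  ∀ n k, a n k ≠ 0 →
    (IsNegInt K n.1 ∧ IsNegInt K n.2) ∧ (IsNegInt K k.1 ∧ IsNegInt K k.2)

/-- membership in M⌊𝐳,𝐰⌋ -/
def InLat2 (a : Dist2 K M) : Prop :=
  ∃ S : Finset (Idx K × Idx K), ∀ n k, a n k ≠ 0 →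
    ∃ m ∈ S, (IsNegInt K (n.1 - m.1.1) ∧ IsNegInt K (n.2 - m.1.2)) ∧
      (IsNegInt K (k.1 - m.2.1) ∧ IsNegInt K (k.2 - m.2.2))

/-- membership in M[[𝐳₁,…,𝐳ᵣ]] -/
def IsPowN {r : ℕ} (a : DistN K M r) : Prop :=
  ∀ n, a n ≠ 0 → ∀ i, IsNegInt K (n i).1 ∧ IsNegInt K (n i).2

/-- membership in M⌊𝐳₁,…,𝐳ᵣ⌋ -/
def InLatN {r : ℕ} (a : DistN K M r) : Prop :=
  ∃ S : Finset (Fin r → Idx K), ∀ n, a n ≠ 0 →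
    ∃ m ∈ S, ∀ i, IsNegInt K ((n i).1 - (m i).1) ∧ IsNegInt K ((n i).2 - (m i).2)

/-- ∂_z -/
def dz (a : Dist1 K M) : Dist1 K M := fun n => (-n.1) • a (n.1 - 1, n.2)

/-- ∂_z̄ -/
def dzb (a : Dist1 K M) : Dist1 K M := fun n => (-n.2) • a (n.1, n.2 - 1)

/-- ∂ in the first variable pair of a two-variable distribution (z-component) -/
def d1z (c : Dist2 K M) : Dist2 K M := fun n k => (-n.1) • c (n.1 - 1, n.2) k

/-- ∂ in the first variable pair of a two-variable distribution (z̄-component) -/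
def d1zb (c : Dist2 K M) : Dist2 K M := fun n k => (-n.2) • c (n.1, n.2 - 1) k

/-- divided power d^{(x)} of an operator d, for a K-valued exponent x
(zero unless x ∈ ℕ) -/
def dPow {A : Type*} [AddCommGroup A] [Module K A] (d : A → A) (x : K) (a : A) : A :=
  if h : ∃ j : ℕ, (j : K) = x then ((h.choose.factorial : K))⁻¹ • d^[h.choose] a else 0

/-- ∂_z^{(e_1)} ∂_z̄^{(e_2)} in the first variable pair -/
def ddPow2 (e : Idx K) (c : Dist2 K M) : Dist2 K M :=
  dPow K (d1z K M) e.1 (dPow K (d1zb K M) e.2 c)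

/-- the diagonal map c(𝐳,𝐰) ↦ c(𝐰,𝐰) -/
def diag (c : Dist2 K M) : Dist1 K M :=
  fun n => ∑ᶠ m : Idx K, c m (n.1 - m.1 - 1, n.2 - m.2 - 1)

/-- multiplication by (𝐳−𝐰)^h (expansion in z>w), on coefficients;
first index is 𝐳, second is 𝐰 -/
def zwPow (h : Idx K) (c : Dist2 K M) : Dist2 K M :=
  fun m k => ∑ᶠ i : ℕ × ℕ,
    ((-1 : K) ^ (i.1 + i.2) * gchoose K h.1 i.1 * gchoose K h.2 i.2) •
      c (m.1 + h.1 - i.1, m.2 + h.2 - i.2) (k.1 + i.1, k.2 + i.2)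

/-- multiplication by ((𝐳−𝐰)_{w>z})^h = (−1)^h (𝐰−𝐳)^h (expansion in w>z) -/
def zwPowW (h : Idx K) (c : Dist2 K M) : Dist2 K M :=
  fun m k => ∑ᶠ i : ℕ × ℕ,
    (negOnePow K (h.1 - h.2) * (-1 : K) ^ (i.1 + i.2) *
        gchoose K h.1 i.1 * gchoose K h.2 i.2) •
      c (m.1 + i.1, m.2 + i.2) (k.1 + h.1 - i.1, k.2 + h.2 - i.2)

/-- multiplication by (𝐱+𝐰)^N of a distribution d(𝐰,𝐱) (first index 𝐰, second 𝐱);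
the result is indexed by (x-index, w-index) -/
def xwPow (N : Idx K) (d : Dist2 K M) : Dist2 K M :=
  fun m k => ∑ᶠ i : ℕ × ℕ, (gchoose K N.1 i.1 * gchoose K N.2 i.2) •
    d (k.1 + i.1, k.2 + i.2) (m.1 + N.1 - i.1, m.2 + N.2 - i.2)

/-- multiplication by (𝐰+𝐱)^N of a distribution d(𝐰,𝐱) (first index 𝐰, second 𝐱);
the result is indexed by (x-index, w-index) -/
def wxPow (N : Idx K) (d : Dist2 K M) : Dist2 K M :=
  fun m k => ∑ᶠ i : ℕ × ℕ, (gchoose K N.1 i.1 * gchoose K N.2 i.2) •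
    d (k.1 + N.1 - i.1, k.2 + N.2 - i.2) (m.1 + i.1, m.2 + i.2)

/-- multiplication by 𝐱^A 𝐰^B (𝐱+𝐰)^N of p(𝐰,𝐱); result indexed (x-index, w-index) -/
def tripleXW (A B N : Idx K) (p : Dist2 K M) : Dist2 K M :=
  fun m k => ∑ᶠ l : ℕ × ℕ, (gchoose K N.1 l.1 * gchoose K N.2 l.2) •
    p (k.1 + B.1 + l.1, k.2 + B.2 + l.2) (m.1 + A.1 + N.1 - l.1, m.2 + A.2 + N.2 - l.2)

/-- multiplication by 𝐱^A 𝐰^B (𝐰+𝐱)^N of p(𝐰,𝐱); result indexed (x-index, w-index) -/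
def tripleWX (A B N : Idx K) (p : Dist2 K M) : Dist2 K M :=
  fun m k => ∑ᶠ l : ℕ × ℕ, (gchoose K N.1 l.1 * gchoose K N.2 l.2) •
    p (k.1 + B.1 + N.1 - l.1, k.2 + B.2 + N.2 - l.2) (m.1 + A.1 + l.1, m.2 + A.2 + l.2)

variable (E : Type*) [AddCommGroup E] [Module K E]

/-- End(E)-valued distributions in one variable pair -/
abbrev EDist1 := Dist1 K (Module.End K E)

/-- End(E)-valued distributions in two variable pairs -/
abbrev EDist2 := Dist2 K (Module.End K E)

/-- End(E)-valued distributions in r variable pairs -/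
abbrev EDistN (r : ℕ) := DistN K (Module.End K E) r

def ev1 (a : EDist1 K E) (v : E) : Dist1 K E := fun n => a n v

def ev2 (c : EDist2 K E) (v : E) : Dist2 K E := fun n k => c n k v

def evN {r : ℕ} (c : EDistN K E r) (v : E) : DistN K E r := fun n => c n v

/-- a(𝐳) is a field -/
def IsFieldD (a : EDist1 K E) : Prop := ∀ v, InLat1 K E (ev1 K E a v)

/-- a field in two variable pairs -/
def IsField2D (c : EDist2 K E) : Prop := ∀ v, InLat2 K E (ev2 K E c v)

/-- the Koszul sign (−1)^{pq} -/
def koszul (p q : ZMod 2) : K := if p = 1 ∧ q = 1 then (-1 : K) else 1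

/-- the data (c^i, 𝐡_i) is an OPE of the homogeneous distributions a(𝐳), b(𝐳)
of parities pa, pb (all identities to be read applied to each vector of E) -/
def IsOPE (pa pb : ZMod 2) (a b : EDist1 K E) {r : ℕ}
    (c : Fin r → EDist2 K E) (h : Fin r → Idx K) : Prop :=
  (∀ i, Kbar K (h i)) ∧ (∀ i, IsField2D K E (c i)) ∧
  (∀ v m k, a m (b k v) = ∑ i, zwPow K E (-(h i)) (ev2 K E (c i) v) m k) ∧
  (∀ v m k, koszul K pa pb • (b k (a m v)) =
      ∑ i, zwPowW K E (-(h i)) (ev2 K E (c i) v) m k)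

/-- a(𝐳), b(𝐳) (homogeneous of parities pa, pb) are local -/
def IsLocal (pa pb : ZMod 2) (a b : EDist1 K E) : Prop :=
  ∃ (r : ℕ) (c : Fin r → EDist2 K E) (h : Fin r → Idx K), IsOPE K E pa pb a b c h

/-- the exponents of an OPE are reduced: 𝐡_i ∉ 𝐡_j + ℤ² for i ≠ j -/
def ReducedExp {r : ℕ} (h : Fin r → Idx K) : Prop :=
  ∀ i j, i ≠ j → ¬ IsIntPair K (h i - h j)

/-- the product field a(𝐰)_{(𝐧)}b(𝐰) built from an OPE (c,h), applied to a vector v -/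
def prodAt {r : ℕ} (c : Fin r → EDist2 K E) (h : Fin r → Idx K) (n : Idx K)
    (v : E) : Dist1 K E :=
  fun m => ∑ i, diag K E
    (ddPow2 K E ((h i).1 - 1 - n.1, (h i).2 - 1 - n.2) (ev2 K E (c i) v)) m

/-- s₁ : a(𝐳) ↦ a_{(−1,−1)}1 -/
def s1 (one : E) (a : EDist1 K E) : E := a ((-1 : K), (-1 : K)) one

/-- the distribution d (to be thought of as a(𝐳)1) equals
Σ_{𝐢∈ℕ²} T^{(i)} T̄^{(ī)} (d_{(−1,−1)}) 𝐳^𝐢, i.e. a(𝐳) is creative -/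
def CreativeD (T Tb : Module.End K E) (d : Dist1 K E) : Prop :=
  (∀ i : ℕ × ℕ, d (-(i.1 : K) - 1, -(i.2 : K) - 1) =
      ((i.1.factorial : K)⁻¹ * (i.2.factorial : K)⁻¹) •
        ((T ^ i.1) * (Tb ^ i.2)) (d ((-1 : K), (-1 : K)))) ∧
  (∀ n : Idx K, (¬ ∃ i : ℕ × ℕ, n = (-(i.1 : K) - 1, -(i.2 : K) - 1)) → d n = 0)

/-- a(𝐳) is translation covariant for (T, T̄) -/
def TransCov (T Tb : Module.End K E) (a : EDist1 K E) : Prop :=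
  (∀ n : Idx K, T * a n - a n * T = (-n.1) • a (n.1 - 1, n.2)) ∧
  (∀ n : Idx K, Tb * a n - a n * Tb = (-n.2) • a (n.1, n.2 - 1))

/-- translation covariance of a product field, per vector -/
def TransCovAt (T Tb : Module.End K E) (P : E → Dist1 K E) : Prop :=
  (∀ v (m : Idx K), T (P v m) - P (T v) m = (-m.1) • P v (m.1 - 1, m.2)) ∧
  (∀ v (m : Idx K), Tb (P v m) - P (Tb v) m = (-m.2) • P v (m.1, m.2 - 1))

/-- the identity field 1(z) = id_E -/
def idField : EDist1 K E :=
  fun n => if n = ((-1 : K), (-1 : K)) then (1 : Module.End K E) else 0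

/-- pairs i < j in [r] -/
abbrev Pairs (r : ℕ) := {p : Fin r × Fin r // p.1 < p.2}

/-- the index shift of the i-th variable produced by the monomial of a binomial
expansion of ((𝐳_{p₁} − 𝐳_{p₂})_σ)^h belonging to 𝐤 ∈ ℕ² -/
def pairShift {r : ℕ} (p : Pairs r) (h : Idx K) (flip : Bool) (kk : ℕ × ℕ)
    (i : Fin r) : Idx K :=
  if i = p.1.1 then
    (if flip then ((kk.1 : K), (kk.2 : K)) else (h.1 - kk.1, h.2 - kk.2))
  else if i = p.1.2 then
    (if flip then (h.1 - kk.1, h.2 - kk.2) else ((kk.1 : K), (kk.2 : K)))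
  else 0

/-- the coefficient of a binomial expansion of ((𝐳_{p₁} − 𝐳_{p₂})_σ)^h
belonging to 𝐤 ∈ ℕ² -/
def pairCoef (h : Idx K) (flip : Bool) (kk : ℕ × ℕ) : K :=
  (if flip then negOnePow K (h.1 - h.2) else 1) * (-1 : K) ^ (kk.1 + kk.2) *
    gchoose K h.1 kk.1 * gchoose K h.2 kk.2

def flipOf {r : ℕ} (σ : Equiv.Perm (Fin r)) (p : Pairs r) : Bool :=
  decide (σ.symm p.1.2 < σ.symm p.1.1)

/-- multiplication by Π_{i<j} ((𝐳_i − 𝐳_j)_σ)^{h_{ij}} on an r-variable distribution -/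
def permMul {r : ℕ} (σ : Equiv.Perm (Fin r)) (hs : Pairs r → Idx K)
    (c : DistN K M r) : DistN K M r :=
  fun m => ∑ᶠ κ : Pairs r → ℕ × ℕ,
    (∏ p : Pairs r, pairCoef K (hs p) (flipOf σ p) (κ p)) •
      c (fun i => m i + ∑ p : Pairs r, pairShift K p (hs p) (flipOf σ p) (κ p) i)

/-- the Koszul sign ζ' produced by reordering a¹,…,aʳ into a^{σ1},…,a^{σr} -/
def koszulPerm {r : ℕ} (ps : Fin r → ZMod 2) (σ : Equiv.Perm (Fin r)) : K :=
  ∏ p : Pairs r,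
    if σ.symm p.1.2 < σ.symm p.1.1 ∧ ps p.1.1 = 1 ∧ ps p.1.2 = 1 then (-1 : K) else 1

/-- the composition a^{σ1}(𝐳_{σ1})_{m_{σ1}} ∘ ⋯ ∘ a^{σr}(𝐳_{σr})_{m_{σr}} applied to v -/
def compSeq {r : ℕ} (a : Fin r → EDist1 K E) (σ : Equiv.Perm (Fin r))
    (m : Fin r → Idx K) (v : E) : E :=
  (List.ofFn fun j : Fin r => σ j).foldr (fun i acc => a i (m i) acc) v

/-- the data (c^α, 𝐡_{ij}^k) is a (multiple) OPE of the homogeneous distributions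
a¹(𝐳),…,aʳ(𝐳) of parities ps -/
def IsMultOPE {r : ℕ} (a : Fin r → EDist1 K E) (ps : Fin r → ZMod 2)
    (rij : Fin r → Fin r → ℕ) (hs : ∀ i j : Fin r, Fin (rij i j) → Idx K)
    (c : ((p : Pairs r) → Fin (rij p.1.1 p.1.2)) → EDistN K E r) : Prop :=
  (∀ i j k, Kbar K (hs i j k)) ∧
  (∀ α v, InLatN K E (evN K E (c α) v)) ∧
  (∀ σ : Equiv.Perm (Fin r), ∀ v m,
    koszulPerm K ps σ • compSeq K E a σ m v =
      ∑ α : (p : Pairs r) → Fin (rij p.1.1 p.1.2),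
        permMul K E σ (fun p => -(hs p.1.1 p.1.2 (α p))) (evN K E (c α) v) m)

/-- a¹(𝐳),…,aʳ(𝐳) are multiply local -/
def MultiplyLocal {r : ℕ} (a : Fin r → EDist1 K E) (ps : Fin r → ZMod 2) : Prop :=
  ∃ (rij : Fin r → Fin r → ℕ) (hs : ∀ i j : Fin r, Fin (rij i j) → Idx K)
    (c : ((p : Pairs r) → Fin (rij p.1.1 p.1.2)) → EDistN K E r),
      IsMultOPE K E a ps rij hs c

/-- a set of homogeneous fields (with parities pF) is multiply local -/
def MultLocalSet (F : Set (EDist1 K E)) (pF : EDist1 K E → ZMod 2) : Prop :=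
  ∀ (r : ℕ) (f : Fin r → EDist1 K E), (∀ i, f i ∈ F) →
    MultiplyLocal K E f (fun i => pF (f i))

/-- a set of homogeneous fields (with parities pF) is uniformly local -/
def UnifLocalSet (F : Set (EDist1 K E)) (pF : EDist1 K E → ZMod 2) (one : E) : Prop :=
  ∃ (rr : EDist1 K E → EDist1 K E → ℕ)
    (hh : ∀ d e : EDist1 K E, Fin (rr d e) → Idx K),
    ∀ (r : ℕ) (f : Fin r → EDist1 K E), (∀ i, f i ∈ F) →
      ∃ c, IsMultOPE K E f (fun i => pF (f i)) (fun i j => rr (f i) (f j))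
          (fun i j => hh (f i) (f j)) c ∧
        ∀ α, IsPowN K E (evN K E (c α) one)

/-- a ∈ V is homogeneous of parity p w.r.t. the grading (ev, od) -/
def memPar {V : Type*} [AddCommGroup V] [Module K V] (ev od : Submodule K V)
    (a : V) (p : ZMod 2) : Prop :=
  (p = 0 ∧ a ∈ ev) ∨ (p = 1 ∧ a ∈ od)

/-- an endomorphism is homogeneous of parity p w.r.t. the grading (ev, od) -/
def EndPar {V : Type*} [AddCommGroup V] [Module K V] (ev od : Submodule K V)
    (f : Module.End K V) (p : ZMod 2) : Prop :=
  if p = 0 then (∀ v ∈ ev, f v ∈ ev) ∧ (∀ v ∈ od, f v ∈ od)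
  else (∀ v ∈ ev, f v ∈ od) ∧ (∀ v ∈ od, f v ∈ ev)

/-- a distribution is homogeneous of parity p -/
def EDistPar {V : Type*} [AddCommGroup V] [Module K V] (ev od : Submodule K V)
    (a : EDist1 K V) (p : ZMod 2) : Prop :=
  ∀ n, EndPar K ev od (a n) p

end OPEA

namespace OPEA

/-- an OPE-algebra -/
structure OPEAlg (K : Type*) [Field K] [CharZero K]
    (V : Type*) [AddCommGroup V] [Module K V] where
  ev : Submodule K V
  od : Submodule K V
  compl : IsCompl ev od
  Y : V →ₗ[K] EDist1 K V
  Y_par : ∀ a p, memPar K ev od a p → ∀ (n : Idx K) b q, memPar K ev od b q →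
    memPar K ev od (Y a n b) (p + q)
  one : V
  one_ev : one ∈ ev
  T : Module.End K V
  Tb : Module.End K V
  T_ev : EndPar K ev od T 0
  Tb_ev : EndPar K ev od Tb 0
  commTTb : T * Tb = Tb * T
  T_one : T one = 0
  Tb_one : Tb one = 0
  wcre : ∀ a, IsPow1 K V (ev1 K V (Y a) one)
  rid : ∀ a, Y a ((-1 : K), (-1 : K)) one = a
  tcov : ∀ a, TransCov K V T Tb (Y a)
  loc : ∀ a b pa pb, memPar K ev od a pa → memPar K ev od b pb →
    IsLocal K V pa pb (Y a) (Y b)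

/-- a bounded 𝕂̄-fold algebra -/
structure BFold (K : Type*) [Field K] [CharZero K]
    (V : Type*) [AddCommGroup V] [Module K V] where
  ev : Submodule K V
  od : Submodule K V
  compl : IsCompl ev od
  Y : V →ₗ[K] EDist1 K V
  Y_par : ∀ a p, memPar K ev od a p → ∀ (n : Idx K) b q, memPar K ev od b q →
    memPar K ev od (Y a n b) (p + q)
  fields : ∀ a, IsFieldD K V (Y a)
  bounded : ∀ a (n : Idx K), ¬ Kbar K n → ∀ b, Y a n b = 0

/-- a bounded 𝕂̄-fold module over a bounded 𝕂̄-fold algebra -/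
structure BMod (K : Type*) [Field K] [CharZero K]
    (V : Type*) [AddCommGroup V] [Module K V] (A : BFold K V)
    (Mo : Type*) [AddCommGroup Mo] [Module K Mo] where
  evM : Submodule K Mo
  odM : Submodule K Mo
  complM : IsCompl evM odM
  YM : V →ₗ[K] EDist1 K Mo
  YM_par : ∀ a p, memPar K A.ev A.od a p → ∀ n : Idx K, EndPar K evM odM (YM a n) p
  fieldsM : ∀ a, IsFieldD K Mo (YM a)
  boundedM : ∀ a (n : Idx K), ¬ Kbar K n → ∀ c, YM a n c = 0

variable (K : Type*) [Field K] [CharZero K]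
variable (V : Type*) [AddCommGroup V] [Module K V]
variable (Mo : Type*) [AddCommGroup Mo] [Module K Mo]

/-- the operator T₁ : a ↦ a_{(−2,−1)}1 of an OPE-algebra -/
def T1 (A : OPEAlg K V) : Module.End K V where
  toFun := fun a => A.Y a ((-2 : K), (-1 : K)) A.one
  map_add' := by
    intro x y
    simp [map_add, Pi.add_apply, LinearMap.add_apply]
  map_smul' := by
    intro c x
    simp [map_smul, Pi.smul_apply, LinearMap.smul_apply]

/-- the operator T̄₁ : a ↦ a_{(−1,−2)}1 of an OPE-algebra -/
def T1b (A : OPEAlg K V) : Module.End K V where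
  toFun := fun a => A.Y a ((-1 : K), (-2 : K)) A.one
  map_add' := by
    intro x y
    simp [map_add, Pi.add_apply, LinearMap.add_apply]
  map_smul' := by
    intro c x
    simp [map_smul, Pi.smul_apply, LinearMap.smul_apply]

/-- skew-symmetry for the pair (T, T̄) -/
def SkewSym (ev od : Submodule K V) (Yf : V → EDist1 K V)
    (T Tb : Module.End K V) : Prop :=
  ∀ a b pa pb, memPar K ev od a pa → memPar K ev od b pb →
    ∀ n : Idx K, Kbar K n →
      (Function.support (fun i : ℕ × ℕ =>
        ((i.1.factorial : K)⁻¹ * (i.2.factorial : K)⁻¹ *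
            negOnePow K (n.1 + i.1 - (n.2 + i.2))) •
          ((T ^ i.1) * (Tb ^ i.2)) (Yf a (n.1 + i.1, n.2 + i.2) b))).Finite ∧
      koszul K pa pb • Yf b n a =
        ∑ᶠ i : ℕ × ℕ, ((i.1.factorial : K)⁻¹ * (i.2.factorial : K)⁻¹ *
            negOnePow K (n.1 + i.1 - (n.2 + i.2))) •
          ((T ^ i.1) * (Tb ^ i.2)) (Yf a (n.1 + i.1, n.2 + i.2) b)

/-- (T, T̄) is a translation endomorphism of the module with state-field map YM -/
def TransEnd (YM : V → EDist1 K Mo) (T Tb : Module.End K V) : Prop :=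
  (∀ a (n : Idx K), YM (T a) n = (-n.1) • YM a (n.1 - 1, n.2)) ∧
  (∀ a (n : Idx K), YM (Tb a) n = (-n.2) • YM a (n.1, n.2 - 1))

/-- the coefficient at (x-index m, w-index k) of a(𝐱+𝐰) applied to the w-distribution bw -/
def lhsXW (YM : V → EDist1 K Mo) (a : V) (bw : Dist1 K Mo) (m k : Idx K) : Mo :=
  ∑ᶠ i : ℕ × ℕ, ((i.1.factorial : K)⁻¹ * (i.2.factorial : K)⁻¹) •
    (((dz K (Module.End K Mo))^[i.1] ((dzb K (Module.End K Mo))^[i.2] (YM a))) m)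
      (bw (k.1 + i.1, k.2 + i.2))

/-- a and cM are dual in the direct channel -/
def DualDirect (Y : V → EDist1 K V) (YM : V → EDist1 K Mo) (a : V) (cM : Mo) : Prop :=
  ∃ (s : ℕ) (d : Fin s → Idx K → Idx K → (V →ₗ[K] Mo)) (hj : Fin s → Idx K),
    (∀ j, Kbar K (hj j)) ∧
    (∀ j b, InLat2 K Mo (fun kw mx => d j kw mx b)) ∧
    (∀ b (m k : Idx K),
      lhsXW K V Mo YM a (fun k' => YM b k' cM) m k =
        ∑ j, xwPow K Mo (-(hj j)) (fun kw mx => d j kw mx b) m k) ∧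
    (∀ b (m k : Idx K),
      YM (Y a m b) k cM =
        ∑ j, wxPow K Mo (-(hj j)) (fun kw mx => d j kw mx b) m k)

/-- a and b are dual in the exchange channel on the module -/
def DualExch (Y : V → EDist1 K V) (YM : V → EDist1 K Mo) (a b : V) : Prop :=
  ∃ (r : ℕ) (hab : Fin r → Idx K), (∀ i, Kbar K (hab i)) ∧
    ∀ cM : Mo, ∃ (s : ℕ) (hac : Fin s → Idx K)
      (q : Fin r → Fin s → Idx K → Idx K → Mo),
      (∀ j, Kbar K (hac j)) ∧
      (∀ i j kw mx, q i j kw mx ≠ 0 → IsNegInt K mx.1 ∧ IsNegInt K mx.2) ∧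
      (∀ i j mx, InLat1 K Mo (fun kw => q i j kw mx)) ∧
      (∀ m k : Idx K,
        lhsXW K V Mo YM a (fun k' => YM b k' cM) m k =
          ∑ j, xwPow K Mo (-(hac j))
            (fun kw mx => ∑ i, q i j kw (mx.1 - (hab i).1, mx.2 - (hab i).2)) m k) ∧
      (∀ m k : Idx K,
        YM (Y a m b) k cM =
          ∑ j, wxPow K Mo (-(hac j))
            (fun kw mx => ∑ i, q i j kw (mx.1 - (hab i).1, mx.2 - (hab i).2)) m k)

/-- the module with state-field map YM is dual -/
def IsDualMod (ev od : Submodule K V) (Y : V → EDist1 K V) (YM : V → EDist1 K Mo) : Prop :=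
  ∃ (rVV : V → V → ℕ) (hVV : ∀ a b : V, Fin (rVV a b) → Idx K)
    (rVM : V → Mo → ℕ) (hVM : ∀ (a : V) (c : Mo), Fin (rVM a c) → Idx K),
    (∀ a b i, Kbar K (hVV a b i)) ∧ (∀ a c j, Kbar K (hVM a c j)) ∧
    ∀ a b pa pb, memPar K ev od a pa → memPar K ev od b pb → ∀ c : Mo,
      ∃ p : Fin (rVV a b) → Fin (rVM a c) → Fin (rVM b c) → Dist2 K Mo,
        (∀ i j k, IsPow2 K Mo (p i j k)) ∧
        (∀ m k : Idx K,
          lhsXW K V Mo YM a (fun k' => YM b k' c) m k =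
            ∑ i, ∑ j, ∑ kk, tripleXW K Mo (-(hVV a b i)) (-(hVM b c kk))
              (-(hVM a c j)) (p i j kk) m k) ∧
        (∀ m k : Idx K,
          YM (Y a m b) k c =
            ∑ i, ∑ j, ∑ kk, tripleWX K Mo (-(hVV a b i)) (-(hVM b c kk))
              (-(hVM a c j)) (p i j kk) m k)

/-- F_Y is multiply local -/
def MultLocalAlg (A : OPEAlg K V) : Prop :=
  ∀ (r : ℕ) (f : Fin r → V) (pf : Fin r → ZMod 2),
    (∀ i, memPar K A.ev A.od (f i) (pf i)) →
      MultiplyLocal K V (fun i => A.Y (f i)) pf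

/-- F_Y is uniformly local -/
def UnifLocalAlg (A : OPEAlg K V) : Prop :=
  ∃ (rr : V → V → ℕ) (hh : ∀ a b : V, Fin (rr a b) → Idx K),
    ∀ (r : ℕ) (f : Fin r → V) (pf : Fin r → ZMod 2),
      (∀ i, memPar K A.ev A.od (f i) (pf i)) →
        ∃ c, IsMultOPE K V (fun i => A.Y (f i)) pf (fun i j => rr (f i) (f j))
            (fun i j => hh (f i) (f j)) c ∧
          ∀ α, IsPowN K V (evN K V (c α) A.one)

end OPEA
namespace OPEA

/-- the coefficients of the binomial series `(1 - X) ^ x` -/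
def signedChoose (K : Type*) [Field K] (x : K) (p : ℕ) : K := (-1 : K) ^ p * gchoose K x p

lemma signedChoose_zero (K : Type*) [Field K] (x : K) : signedChoose K x 0 = 1 := by
  simp [signedChoose, gchoose]

lemma signedChoose_succ (K : Type*) [Field K] [CharZero K] (x : K) (p : ℕ) :
    ((p : K) + 1) * signedChoose K x (p + 1) = (p - x) * signedChoose K x p := by
  have h1 : ((p : K) + 1) ≠ 0 := Nat.cast_add_one_ne_zero p
  have h2 : ((p.factorial : ℕ) : K) ≠ 0 := Nat.cast_ne_zero.2 p.factorial_ne_zero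
  simp only [signedChoose, gchoose, Finset.prod_range_succ, Nat.factorial_succ]
  push_cast
  field_simp
  ring

/-- the binomial series `(1 - X) ^ x` -/
def binomSeries (K : Type*) [Field K] (x : K) : PowerSeries K :=
  PowerSeries.mk (signedChoose K x)

lemma binomSeries_ne_zero (K : Type*) [Field K] (x : K) : binomSeries K x ≠ 0 := by
  intro h
  have := congrArg (PowerSeries.coeff 0) h
  simp [binomSeries, signedChoose_zero] at this

lemma one_sub_X_mul_derivative_binomSeries (K : Type*) [Field K] [CharZero K] (x : K) :
    (1 - PowerSeries.X) * PowerSeries.derivative K (binomSeries K x) =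
      PowerSeries.C (-x) * binomSeries K x := by
  ext n
  rw [sub_mul, one_mul, map_sub, PowerSeries.coeff_C_mul]
  cases n with
  | zero =>
    have := signedChoose_succ K x 0
    simp [PowerSeries.coeff_derivative, binomSeries] at this ⊢
    linear_combination this
  | succ n =>
    have := signedChoose_succ K x (n + 1)
    simp [PowerSeries.coeff_succ_X_mul, PowerSeries.coeff_derivative, binomSeries] at this ⊢
    linear_combination this

/-- binomial series whose exponents differ by non-integers are linearly independent
over the polynomials -/
lemma binomSeries_linearIndependent (K : Type*) [Field K] [CharZero K] {ι : Type*} (x : ι → K)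
    (hx : ∀ i j, i ≠ j → ¬ IsInt K (x i - x j)) (s : Finset ι) :
    ∀ q : ι → Polynomial K, ∑ j ∈ s, binomSeries K (x j) * (q j : PowerSeries K) = 0 →
      ∀ j ∈ s, q j = 0 := by
  induction s using Finset.induction_on with
  | empty => simp
  | insert i s his ih =>
    have key : ∀ n : ℕ, ∀ q : ι → Polynomial K, (∀ m, n ≤ m → (q i).coeff m = 0) →
        ∑ j ∈ insert i s, binomSeries K (x j) * (q j : PowerSeries K) = 0 →
        ∀ j ∈ insert i s, q j = 0 := by
      intro n
      induction n with
      | zero =>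
        intro q hq hsum
        have hqi : q i = 0 := by
          ext m; simpa using hq m (Nat.zero_le m)
        rw [Finset.sum_insert his, hqi] at hsum
        intro j hj
        rcases Finset.mem_insert.1 hj with rfl | hj
        · exact hqi
        · exact ih q (by simpa using hsum) j hj
      | succ n ihn =>
        intro q hq hsum
        set μ : ι → K := fun j => n + x i - x j with hμ
        let q' : ι → Polynomial K := fun j =>
          (1 - Polynomial.X) * Polynomial.derivative (q j) + Polynomial.C (μ j) * q j
        have hcoeff : ∀ j m, (∀ l, m < l → (q j).coeff l = 0) →
            (q' j).coeff m = (μ j - m) * (q j).coeff m := by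
          intro j m hm
          have h1 := hm (m + 1) (Nat.lt_succ_self m)
          cases m with
          | zero => simp [q', sub_mul, Polynomial.coeff_derivative, h1]
          | succ m =>
            simp [q', sub_mul, Polynomial.coeff_derivative, Polynomial.coeff_X_mul, h1]
            ring
        have hsum' : ∑ j ∈ insert i s, binomSeries K (x j) * (q' j : PowerSeries K) = 0 := by
          have hterm : ∀ j, binomSeries K (x j) * (q' j : PowerSeries K) =
              (1 - PowerSeries.X) *
                PowerSeries.derivative K (binomSeries K (x j) * (q j : PowerSeries K)) +
              PowerSeries.C (n + x i) * (binomSeries K (x j) * (q j : PowerSeries K)) := by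
            intro j
            have hd := one_sub_X_mul_derivative_binomSeries K (x j)
            rw [Derivation.leibniz, PowerSeries.derivative_coe]
            simp only [q', hμ, Polynomial.coe_add, Polynomial.coe_mul, Polynomial.coe_sub,
              Polynomial.coe_one, Polynomial.coe_X, Polynomial.coe_C, smul_eq_mul, map_sub]
            rw [map_neg] at hd
            linear_combination (-(q j : PowerSeries K)) * hd
          rw [Finset.sum_congr rfl fun j _ => hterm j, Finset.sum_add_distrib, ← Finset.mul_sum,
            ← Finset.mul_sum, ← map_sum, hsum]
          simp
        have hq' := ihn q' (fun m hm => by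
          rw [hcoeff i m fun l hl => hq l (by omega)]
          rcases hm.eq_or_lt with rfl | hm
          · simp [hμ]
          · rw [hq m hm, mul_zero]) hsum'
        have hz : ∀ j ∈ s, q j = 0 := by
          intro j hj
          by_contra hne
          have h0 := hcoeff j (q j).natDegree fun l hl =>
            Polynomial.coeff_eq_zero_of_natDegree_lt hl
          rw [hq' j (Finset.mem_insert_of_mem hj), Polynomial.coeff_zero] at h0
          rcases mul_eq_zero.1 h0.symm with h0 | h0
          · refine hx j i (fun e => his (e ▸ hj)) ⟨(n : ℤ) - (q j).natDegree, ?_⟩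
            push_cast
            simp only [hμ] at h0
            linear_combination h0
          · exact hne (Polynomial.leadingCoeff_eq_zero.1 h0)
        intro j hj
        rcases Finset.mem_insert.1 hj with rfl | hj
        · rw [Finset.sum_insert his,
            Finset.sum_eq_zero fun l hl => by rw [hz l hl]; simp, add_zero] at hsum
          exact Polynomial.coe_eq_zero_iff.1
            ((mul_eq_zero.1 hsum).resolve_left (binomSeries_ne_zero K _))
        · exact hz j hj
    intro q hsum
    exact key ((q i).natDegree + 1) q
      (fun m hm => Polynomial.coeff_eq_zero_of_natDegree_lt hm) hsum

/-- independence of binomial series over Laurent polynomials with coefficients in a vector space,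
in terms of coefficients -/
lemma eq_zero_of_sum_signedChoose (K : Type*) [Field K] [CharZero K]
    {E : Type*} [AddCommGroup E] [Module K E] {ι : Type*} [Fintype ι] (x : ι → K)
    (hx : ∀ i j, i ≠ j → ¬ IsInt K (x i - x j)) (g : ι → ℤ → E) (N : ℤ)
    (hg : ∀ j s, g j s ≠ 0 → -N ≤ s ∧ s ≤ N)
    (hsum : ∀ n : ℕ, ∑ j, ∑ p ∈ Finset.range (n + 1),
      signedChoose K (x j) p • g j (N - n + p) = 0) :
    ∀ j s, g j s = 0 := by
  intro i s
  by_contra hne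
  rw [← Module.forall_dual_apply_eq_zero_iff K] at hne
  push Not at hne
  obtain ⟨φ, hφ⟩ := hne
  let q : ι → Polynomial K := fun j =>
    ∑ l ∈ Finset.range ((2 * N).toNat + 1), Polynomial.monomial l (φ (g j (N - l)))
  have hq : ∀ j l, (q j).coeff l = φ (g j (N - l)) := by
    intro j l
    simp only [q, Polynomial.finsetSum_coeff, Polynomial.coeff_monomial, Finset.sum_ite_eq',
      Finset.mem_range]
    split_ifs with hl
    · rfl
    · by_contra h0
      have := hg j (N - l) fun h => h0 (by simp [h])
      omega
  have hs : -N ≤ s ∧ s ≤ N := hg i s fun h => hφ (by simp [h])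
  have hzero := binomSeries_linearIndependent K x hx Finset.univ q (by
    ext n
    have h1 := congrArg φ (hsum n)
    simp only [map_sum, map_smul, map_zero, smul_eq_mul] at h1
    rw [map_sum, map_zero, ← h1]
    refine Finset.sum_congr rfl fun j _ => ?_
    rw [PowerSeries.coeff_mul, Finset.Nat.sum_antidiagonal_eq_sum_range_succ_mk]
    refine Finset.sum_congr rfl fun p hp => ?_
    have hp' : p ≤ n := Nat.lt_succ_iff.1 (Finset.mem_range.1 hp)
    simp only [binomSeries, PowerSeries.coeff_mk, Polynomial.coeff_coe, hq]
    rw [Nat.cast_sub hp', sub_sub_eq_add_sub, sub_add_eq_add_sub]) i (Finset.mem_univ i)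
  apply hφ
  have h2 := hq i (N - s).toNat
  rw [hzero, Polynomial.coeff_zero, Int.toNat_of_nonneg (by omega), sub_sub_cancel] at h2
  exact h2.symm

/-- every point of a bounded support lies below a maximal one -/
lemma exists_maximal_shift {E : Type*} [AddCommGroup E] (f : ℤ → ℤ → E) (N : ℤ)
    (hf : ∀ s t, f s t ≠ 0 → s ≤ N ∧ t ≤ N) {s t : ℤ} (hst : f s t ≠ 0) :
    ∃ i : ℕ × ℕ, f (s + i.1) (t + i.2) ≠ 0 ∧
      ∀ j : ℕ × ℕ, j ≠ 0 → f (s + i.1 + j.1) (t + i.2 + j.2) = 0 := by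
  let P : ℕ → Prop := fun n => ∃ i : ℕ × ℕ, i.1 + i.2 = n ∧ f (s + i.1) (t + i.2) ≠ 0
  have hP0 : P 0 := ⟨0, rfl, by simpa using hst⟩
  have hbd : ∀ n, P n → n ≤ (N - s + (N - t)).toNat := by
    rintro n ⟨i, rfl, hi⟩
    have := hf _ _ hi
    omega
  obtain ⟨i, hi, hne⟩ := Nat.findGreatest_spec (P := P)
    (Nat.zero_le (N - s + (N - t)).toNat) hP0
  refine ⟨i, hne, fun j hj => ?_⟩
  by_contra h0
  have hPj : P ((i.1 + j.1) + (i.2 + j.2)) :=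
    ⟨(i.1 + j.1, i.2 + j.2), rfl, by push_cast; simpa only [add_assoc] using h0⟩
  have hle := Nat.le_findGreatest (hbd _ hPj) hPj
  have hj' : j.1 + j.2 ≠ 0 := by
    intro h
    exact hj (Prod.ext (by simp; omega) (by simp; omega))
  omega

lemma exists_int_bound (K : Type*) [Field K] [CharZero K] (x : K) :
    ∃ N : ℤ, ∀ s : ℤ, IsNegInt K (x + s) → s ≤ N := by
  by_cases hx : IsInt K x
  · obtain ⟨n, rfl⟩ := hx
    refine ⟨-n, ?_⟩
    rintro s ⟨k, hk, hks⟩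
    have : k = n + s := by exact_mod_cast hks
    omega
  · refine ⟨0, ?_⟩
    rintro s ⟨k, -, hks⟩
    exact absurd ⟨k - s, by push_cast; linear_combination hks⟩ hx

/-- the coefficients of `c ∈ M⌊𝐳,𝐰⌋` of fixed total degree are finite in number -/
lemma InLat2.exists_bound {K : Type*} [Field K] [CharZero K]
    {M : Type*} [AddCommGroup M] [Module K M] {c : Dist2 K M} (hc : InLat2 K M c) (m k : Idx K) :
    ∃ N : ℤ, ∀ s t : ℤ, c (m.1 - s, m.2 - t) (k.1 + s, k.2 + t) ≠ 0 →
      (-N ≤ s ∧ s ≤ N) ∧ (-N ≤ t ∧ t ≤ N) := by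
  obtain ⟨S, hS⟩ := hc
  choose B hB using exists_int_bound K
  let Bd : Idx K × Idx K → ℤ := fun p => |B (m.1 - p.1.1)| + |B (m.2 - p.1.2)| +
    |B (k.1 - p.2.1)| + |B (k.2 - p.2.2)|
  refine ⟨∑ p ∈ S, Bd p, fun s t hst => ?_⟩
  obtain ⟨p, hp, ⟨h1, h2⟩, h3, h4⟩ := hS _ _ hst
  have hle : Bd p ≤ ∑ p ∈ S, Bd p :=
    Finset.single_le_sum (f := Bd) (fun p _ => by positivity) hp
  have b1 := hB (m.1 - p.1.1) (-s) (by convert h1 using 1; push_cast; ring)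
  have b2 := hB (m.2 - p.1.2) (-t) (by convert h2 using 1; push_cast; ring)
  have b3 := hB (k.1 - p.2.1) s (by convert h3 using 1; ring)
  have b4 := hB (k.2 - p.2.2) t (by convert h4 using 1; ring)
  have a1 := le_abs_self (B (m.1 - p.1.1))
  have a2 := le_abs_self (B (m.2 - p.1.2))
  have a3 := le_abs_self (B (k.1 - p.2.1))
  have a4 := le_abs_self (B (k.2 - p.2.2))
  have n1 := abs_nonneg (B (m.1 - p.1.1))
  have n2 := abs_nonneg (B (m.2 - p.1.2))
  have n3 := abs_nonneg (B (k.1 - p.2.1))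
  have n4 := abs_nonneg (B (k.2 - p.2.2))
  simp only [Bd] at hle
  refine ⟨⟨?_, ?_⟩, ?_, ?_⟩ <;> linarith

/-- coefficientwise form of the independence of the products
`(1 - X) ^ (x j).1 * (1 - Y) ^ (x j).2` over Laurent polynomials -/
lemma eq_zero_of_sum_finsum_signedChoose (K : Type*) [Field K] [CharZero K]
    {E : Type*} [AddCommGroup E] [Module K E] {ι : Type*} [Fintype ι] (x : ι → Idx K)
    (hx : ∀ i j, i ≠ j → ¬ IsInt K ((x i).1 - (x j).1)) (f : ι → ℤ → ℤ → E)
    (hf : ∀ j, ∃ N : ℤ, ∀ s t, f j s t ≠ 0 → (-N ≤ s ∧ s ≤ N) ∧ (-N ≤ t ∧ t ≤ N))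
    (hsum : ∀ s t : ℤ, ∑ j, ∑ᶠ i : ℕ × ℕ,
      (signedChoose K (x j).1 i.1 * signedChoose K (x j).2 i.2) •
        f j (s + i.1) (t + i.2) = 0) :
    ∀ j s t, f j s t = 0 := by
  choose B hB using hf
  set N : ℤ := ∑ j, |B j| with hN
  have hfN : ∀ j s t, f j s t ≠ 0 → (-N ≤ s ∧ s ≤ N) ∧ (-N ≤ t ∧ t ≤ N) := by
    intro j s t h
    have h1 := hB j s t h
    have h2 : |B j| ≤ N :=
      Finset.single_le_sum (f := fun j => |B j|) (fun j _ => abs_nonneg _) (Finset.mem_univ j)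
    have h3 := le_abs_self (B j)
    omega
  let g : ℕ → ι → ℤ → E := fun l j s =>
    ∑ q ∈ Finset.range (l + 1), signedChoose K (x j).2 q • f j s (N - l + q)
  have hg : ∀ l j s, g l j s = 0 := by
    intro l
    refine eq_zero_of_sum_signedChoose K (fun j => (x j).1) hx (g l) N ?_ ?_
    · intro j s h
      obtain ⟨q, -, hq⟩ := Finset.exists_ne_zero_of_sum_ne_zero h
      exact (hfN j _ _ (right_ne_zero_of_smul hq)).1
    · intro n
      rw [← hsum (N - n) (N - l)]
      refine Finset.sum_congr rfl fun j _ => ?_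
      rw [finsum_eq_sum_of_support_subset
        (s := Finset.range (n + 1) ×ˢ Finset.range (l + 1)) _ ?_, Finset.sum_product]
      · refine Finset.sum_congr rfl fun p _ => ?_
        simp only [g, Finset.smul_sum, smul_smul]
      · intro i hi
        have := hfN j _ _ (right_ne_zero_of_smul hi)
        simp only [Finset.coe_product, Set.mem_prod, Finset.mem_coe, Finset.mem_range]
        omega
  intro j s t
  by_contra hne
  obtain ⟨i, hi, hi'⟩ := exists_maximal_shift (f j) N
    (fun s t h => ⟨(hfN j s t h).1.2, (hfN j s t h).2.2⟩) hne
  apply hi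
  have h1 := hfN j _ _ hi
  have h2 := hg (N - (t + i.2)).toNat j (s + i.1)
  simp only [g] at h2
  rw [Int.toNat_of_nonneg (by omega), sub_sub_cancel, Finset.sum_range_succ',
    Finset.sum_eq_zero fun q _ => by
      have := hi' (0, q + 1) (by simp)
      simp only [Nat.cast_zero, add_zero] at this
      rw [this, smul_zero]] at h2
  simpa [signedChoose_zero] using h2

lemma zwPow_eq_finsum_signedChoose (K : Type*) [Field K]
    {M : Type*} [AddCommGroup M] [Module K M] (x : Idx K) (c : Dist2 K M) (m k : Idx K)
    (s t : ℤ) :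
    zwPow K M x c (m.1 - x.1 - s, m.2 - x.2 - t) (k.1 + s, k.2 + t) =
      ∑ᶠ i : ℕ × ℕ, (signedChoose K x.1 i.1 * signedChoose K x.2 i.2) •
        c (m.1 - ((s + i.1 : ℤ) : K), m.2 - ((t + i.2 : ℤ) : K))
          (k.1 + ((s + i.1 : ℤ) : K), k.2 + ((t + i.2 : ℤ) : K)) := by
  refine finsum_congr fun i => ?_
  congr 1
  · simp only [signedChoose]; ring
  · congr 1 <;> ext <;> push_cast <;> ring

/-- if a sum `∑ (𝐳 - 𝐰) ^ (x j) d j` with `x` reduced contains only integral powers of `𝐰`,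
then so does each `d j` -/
lemma isIntPair_of_sum_zwPow (K : Type*) [Field K] [CharZero K]
    {E : Type*} [AddCommGroup E] [Module K E] {ι : Type*} [Fintype ι] (x : ι → Idx K)
    (hx : ∀ i j, i ≠ j → ¬ IsInt K ((x i).1 - (x j).1)) (d : ι → Dist2 K E)
    (hd : ∀ j, InLat2 K E (d j))
    (hF : ∀ m k, ∑ j, zwPow K E (x j) (d j) m k ≠ 0 → IsIntPair K k)
    (i : ι) (m k : Idx K) (hne : d i m k ≠ 0) : IsIntPair K k := by
  by_contra hk
  let M : ι → Idx K := fun j => (m.1 - (x i).1 + (x j).1, m.2 - (x i).2 + (x j).2)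
  have h0 := eq_zero_of_sum_finsum_signedChoose K x hx
    (fun j s t => d j ((M j).1 - s, (M j).2 - t) (k.1 + s, k.2 + t))
    (fun j => (hd j).exists_bound (M j) k) (by
      intro s t
      by_contra h
      rw [Finset.sum_congr rfl fun j _ =>
        (zwPow_eq_finsum_signedChoose K (x j) (d j) (M j) k s t).symm] at h
      simp only [M, add_sub_cancel_right] at h
      obtain ⟨⟨u, hu⟩, ⟨v, hv⟩⟩ := hF _ _ h
      exact hk ⟨⟨u - s, by push_cast; rw [hu]; ring⟩, ⟨v - t, by push_cast; rw [hv]; ring⟩⟩)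
    i 0 0
  apply hne
  simpa [M] using h0

/-- if `(𝐳 - 𝐰) ^ x d` contains only nonnegative integral powers of `𝐰`, then so does `d` -/
lemma isNegInt_of_zwPow (K : Type*) [Field K] [CharZero K]
    {E : Type*} [AddCommGroup E] [Module K E] (x : Idx K) (d : Dist2 K E) (hd : InLat2 K E d)
    (hF : ∀ m k, zwPow K E x d m k ≠ 0 → IsNegInt K k.1 ∧ IsNegInt K k.2)
    (m k : Idx K) (hne : d m k ≠ 0) : IsNegInt K k.1 ∧ IsNegInt K k.2 := by
  obtain ⟨N, hN⟩ := hd.exists_bound m k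
  obtain ⟨i, hi, hi'⟩ := exists_maximal_shift
    (fun s t : ℤ => d (m.1 - s, m.2 - t) (k.1 + s, k.2 + t)) N
    (fun s t h => ⟨(hN s t h).1.2, (hN s t h).2.2⟩) (s := 0) (t := 0) (by simpa using hne)
  simp only [zero_add] at hi hi'
  obtain ⟨⟨u, hu, hu'⟩, ⟨v, hv, hv'⟩⟩ := hF (m.1 - x.1 - (i.1 : ℤ), m.2 - x.2 - (i.2 : ℤ))
    (k.1 + (i.1 : ℤ), k.2 + (i.2 : ℤ)) (by
      rw [zwPow_eq_finsum_signedChoose, finsum_eq_single _ 0 fun j hj => by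
        rw [hi' j hj, smul_zero]]
      simpa [signedChoose_zero] using hi)
  exact ⟨⟨u - i.1, by omega, by push_cast at hu' ⊢; rw [hu']; ring⟩,
    ⟨v - i.2, by omega, by push_cast at hv' ⊢; rw [hv']; ring⟩⟩

/-- if every `d j` contains only integral powers and a sum `∑ (𝐳 - 𝐰) ^ (x j) d j` with `x` reduced
contains only nonnegative integral powers of `𝐰`, then so does each `d j` -/
lemma isNegInt_of_sum_zwPow (K : Type*) [Field K] [CharZero K]
    {E : Type*} [AddCommGroup E] [Module K E] {ι : Type*} [Fintype ι] (x : ι → Idx K)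
    (hx : ∀ i j, i ≠ j → ¬ IsInt K ((x i).1 - (x j).1)) (d : ι → Dist2 K E)
    (hd : ∀ j, InLat2 K E (d j)) (hint : ∀ j m k, d j m k ≠ 0 → IsIntPair K m)
    (hF : ∀ m k, ∑ j, zwPow K E (x j) (d j) m k ≠ 0 → IsNegInt K k.1 ∧ IsNegInt K k.2)
    (i : ι) (m k : Idx K) (hne : d i m k ≠ 0) : IsNegInt K k.1 ∧ IsNegInt K k.2 := by
  have hz : ∀ j m k, zwPow K E (x j) (d j) m k ≠ 0 → IsInt K (m.1 + (x j).1) := by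
    intro j m k h
    by_contra hm
    refine h (finsum_eq_zero_of_forall_eq_zero fun l => ?_)
    by_contra hl
    obtain ⟨u, hu⟩ := (hint j _ _ (right_ne_zero_of_smul hl)).1
    exact hm ⟨u + l.1, by push_cast; rw [hu]; ring⟩
  refine isNegInt_of_zwPow K (x i) (d i) (hd i) (fun m k h => hF m k ?_) m k hne
  rw [Finset.sum_eq_single i]
  · exact h
  · intro j _ hji
    by_contra h'
    obtain ⟨u, hu⟩ := hz i m k h
    obtain ⟨v, hv⟩ := hz j m k h'
    exact hx j i hji ⟨v - u, by push_cast; rw [hu, hv]; ring⟩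
  · simp

lemma negOnePow_ne_zero (K : Type*) [Field K] (x : K) : negOnePow K x ≠ 0 := by
  unfold negOnePow
  split_ifs
  · exact zpow_ne_zero _ (neg_ne_zero.2 one_ne_zero)
  · exact one_ne_zero

/-- exchanging the variables turns the expansion in `w > z` into the one in `z > w` -/
lemma zwPowW_eq_zwPow (K : Type*) [Field K] {M : Type*} [AddCommGroup M] [Module K M]
    (x : Idx K) (c : Dist2 K M) (m k : Idx K) :
    zwPowW K M x c m k =
      zwPow K M x (fun k' m' => negOnePow K (x.1 - x.2) • c m' k') k m := by
  refine finsum_congr fun i => ?_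
  rw [smul_smul]
  congr 1
  ring

lemma InLat2.smul_swap {K : Type*} [Field K] {M : Type*} [AddCommGroup M] [Module K M]
    {c : Dist2 K M} (hc : InLat2 K M c) (u : K) :
    InLat2 K M (fun k m => u • c m k) := by
  obtain ⟨S, hS⟩ := hc
  refine ⟨S.image Prod.swap, fun k m h => ?_⟩
  obtain ⟨p, hp, h1, h2⟩ := hS m k (right_ne_zero_of_smul h)
  exact ⟨p.swap, Finset.mem_image_of_mem _ hp, h2, h1⟩

lemma IsNegInt.isInt {K : Type*} [Field K] {x : K} (h : IsNegInt K x) : IsInt K x :=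
  let ⟨k, _, hk⟩ := h
  ⟨k, hk⟩

/-- in a reduced OPE of weakly creative local distributions,
each c^i(𝐳,𝐰)1 is a power series in both variable pairs. -/
theorem stmt_4 (K : Type*) [Field K] [CharZero K]
    (E : Type*) [AddCommGroup E] [Module K E]
    (evE odE : Submodule K E) (hgr : IsCompl evE odE)
    (one : E) (hone : one ∈ evE)
    (a b : EDist1 K E) (pa pb : ZMod 2)
    (ha : EDistPar K evE odE a pa) (hb : EDistPar K evE odE b pb)
    (hwa : IsPow1 K E (ev1 K E a one)) (hwb : IsPow1 K E (ev1 K E b one))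
    {r : ℕ} (c : Fin r → EDist2 K E) (h : Fin r → Idx K)
    (hch : IsOPE K E pa pb a b c h) (hred : ReducedExp K h) :
    ∀ i, IsPow2 K E (ev2 K E (c i) one) := by
  obtain ⟨hKbar, hfield, hzw, hwz⟩ := hch
  have hx : ∀ i j, i ≠ j → ¬ IsInt K ((-(h i)).1 - (-(h j)).1) := by
    rintro i j hij ⟨u, hu⟩
    obtain ⟨v, hv⟩ := hKbar i
    obtain ⟨w, hw⟩ := hKbar j
    simp only [Prod.fst_neg] at hu
    refine hred i j hij ⟨⟨-u, ?_⟩, ⟨-u - v + w, ?_⟩⟩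
    · push_cast
      simp only [Prod.fst_sub]
      linear_combination -hu
    · push_cast
      simp only [Prod.snd_sub]
      linear_combination -hu - hv + hw
  have hF1 : ∀ m k, ∑ j, zwPow K E (-(h j)) (ev2 K E (c j) one) m k ≠ 0 →
      IsNegInt K k.1 ∧ IsNegInt K k.2 := by
    intro m k hne
    rw [← hzw one m k] at hne
    exact hwb k fun h0 => hne (by rw [show b k one = 0 from h0, map_zero])
  let e : Fin r → K := fun j => negOnePow K ((-(h j)).1 - (-(h j)).2)
  let d : Fin r → Dist2 K E := fun j k m => e j • ev2 K E (c j) one m k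
  have hd : ∀ j m k, ev2 K E (c j) one m k ≠ 0 → d j k m ≠ 0 := fun j m k hne =>
    smul_ne_zero (negOnePow_ne_zero K _) hne
  have hF2 : ∀ k m, ∑ j, zwPow K E (-(h j)) (d j) k m ≠ 0 →
      IsNegInt K m.1 ∧ IsNegInt K m.2 := by
    intro k m hne
    have heq : ∑ j, zwPow K E (-(h j)) (d j) k m = koszul K pa pb • b k (a m one) := by
      rw [hwz one m k]
      exact Finset.sum_congr rfl fun j _ => (zwPowW_eq_zwPow K _ _ m k).symm
    rw [heq] at hne
    exact hwa m fun h0 => hne (by rw [show a m one = 0 from h0, map_zero, smul_zero])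
  have hlat : ∀ j, InLat2 K E (d j) := fun j => (hfield j one).smul_swap (e j)
  have hint1 := isIntPair_of_sum_zwPow K (fun j => -(h j)) hx (fun j => ev2 K E (c j) one)
    (fun j => hfield j one) fun m k hne => ⟨(hF1 m k hne).1.isInt, (hF1 m k hne).2.isInt⟩
  have hint2 := isIntPair_of_sum_zwPow K (fun j => -(h j)) hx d hlat
    fun k m hne => ⟨(hF2 k m hne).1.isInt, (hF2 k m hne).2.isInt⟩
  intro i m k hne
  exact ⟨isNegInt_of_sum_zwPow K (fun j => -(h j)) hx d hlat
      (fun j k m h' => hint1 j m k (right_ne_zero_of_smul h')) hF2 i k m (hd i m k hne),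
    isNegInt_of_sum_zwPow K (fun j => -(h j)) hx (fun j => ev2 K E (c j) one)
      (fun j => hfield j one) (fun j m k h' => hint2 j k m (hd j m k h')) hF1 i m k hne⟩

end OPEA
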